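/- Let p⃗ ∈ [1,∞]^m, let p be given by 1/p = Σ_{j=1}^m 1/p_j, assume mp > 1, and let w⃗ ∈ A_{p⃗} with w := ∏_{j=1}^m w_j. Then the weight w^p belongs to the Muckenhoupt class A_{mp} and [w^p]_{A_{mp}} ≤ [w⃗]_{p⃗}^p. -/

import Mathlib

open MeasureTheory ENNReal Set

noncomputable section

namespace Paper

variable {d m : ℕ}

abbrev Rd (d : ℕ) := Fin d → ℝ

structure Cube (d : ℕ) where
  corner : Rd d
  side : ℝ
  side_pos : 0 < side

def Cube.set (Q : Cube d) : Set (Rd d) :=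
  {x | ∀ i, Q.corner i ≤ x i ∧ x i < Q.corner i + Q.side}

/-- the average `⟨f⟩_{q,Q}` for finite exponent `q`, of an `ℝ≥0∞`-valued function -/
def eAvg (f : Rd d → ℝ≥0∞) (q : ℝ) (Q : Cube d) : ℝ≥0∞ :=
  ((volume Q.set)⁻¹ * ∫⁻ x in Q.set, f x ^ q) ^ (1 / q)

def ofFn (f : Rd d → ℝ) : Rd d → ℝ≥0∞ := fun x => ENNReal.ofReal |f x|

/-- the average `⟨f⟩_{q,Q}` for finite exponent `q > 0` -/
def avg (f : Rd d → ℝ) (q : ℝ) (Q : Cube d) : ℝ≥0∞ := eAvg (ofFn f) q Q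

/-- the average `⟨f⟩_{q,Q}` for exponent `q ∈ (0,∞]` -/
def avgE (f : Rd d → ℝ) (q : ℝ≥0∞) (Q : Cube d) : ℝ≥0∞ :=
  if q = ∞ then essSup (ofFn f) (volume.restrict Q.set) else avg f q.toReal Q

def IsWeight (u : Rd d → ℝ) : Prop :=
  MeasureTheory.LocallyIntegrable u volume ∧ ∀ᵐ x ∂(volume : Measure (Rd d)), 0 < u x

/-- `u(A) = ∫_A u dx` -/
def wMeas (u : Rd d → ℝ) (A : Set (Rd d)) : ℝ≥0∞ := ∫⁻ x in A, ENNReal.ofReal (u x)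

/-- the Hardy–Littlewood maximal operator -/
def maximal (f : Rd d → ℝ) (x : Rd d) : ℝ≥0∞ :=
  ⨆ (Q : Cube d) (_ : x ∈ Q.set), avg f 1 Q

/-- the Fujii–Wilson constant `[u]_FW` -/
def FW (u : Rd d → ℝ) : ℝ≥0∞ :=
  ⨆ Q : Cube d, (wMeas u Q.set)⁻¹ * ∫⁻ x in Q.set, maximal (Q.set.indicator u) x

/-- Hölder conjugate in `ℝ≥0∞` -/
def conj (q : ℝ≥0∞) : ℝ≥0∞ := (1 - q⁻¹)⁻¹

def prodW (w : Fin m → Rd d → ℝ) : Rd d → ℝ := fun x => ∏ j, w j x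

/-- the two-weight multilinear Muckenhoupt constant `[w⃗,ω]_{p⃗}`; here `p0` is the
real number with `1/p0 = ∑ 1/p j`. -/
def APtw (p0 : ℝ) (p : Fin m → ℝ≥0∞) (w : Fin m → Rd d → ℝ) (ω : Rd d → ℝ) : ℝ≥0∞ :=
  ⨆ Q : Cube d, avg ω p0 Q * ∏ j, avgE (fun x => (w j x)⁻¹) (conj (p j)) Q

/-- the multilinear Muckenhoupt constant `[w⃗]_{p⃗}` -/
def AP (p0 : ℝ) (p : Fin m → ℝ≥0∞) (w : Fin m → Rd d → ℝ) : ℝ≥0∞ :=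
  APtw p0 p w (prodW w)

def IsSparse (η : ℝ) (S : Set (Cube d)) : Prop :=
  ∃ E : Cube d → Set (Rd d),
    (∀ Q ∈ S, E Q ⊆ Q.set ∧ MeasurableSet (E Q) ∧
      ENNReal.ofReal η * volume Q.set ≤ volume (E Q)) ∧
    S.PairwiseDisjoint E

def dyadicGrid (d : ℕ) (α : Rd d) : Set (Cube d) :=
  {Q | ∃ (j : ℤ) (k : Fin d → ℤ),
    Q.side = (2:ℝ) ^ (-j) ∧ ∀ i, Q.corner i = (2:ℝ) ^ (-j) * (α i + k i)}

def IsDyadicGrid (D : Set (Cube d)) : Prop :=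
  ∃ α : Rd d, (∀ i, α i = 0 ∨ α i = 1/3 ∨ α i = 2/3) ∧ D = dyadicGrid d α

/-- bounded, compactly supported, measurable -/
def BCS (f : Rd d → ℝ) : Prop :=
  Measurable f ∧ (∃ C, ∀ x, |f x| ≤ C) ∧ HasCompactSupport f

def sparseForm (S : Set (Cube d)) (f : Fin m → Rd d → ℝ) (g : Rd d → ℝ) : ℝ≥0∞ :=
  ∑' Q : S, (∏ j, avg (f j) 1 Q.1) * avg g 1 Q.1 * volume (Q.1).set

def SparseFormDom (T : (Fin m → Rd d → ℝ) → Rd d → ℝ) (CT : ℝ≥0∞) : Prop :=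
  ∀ (f : Fin m → Rd d → ℝ) (g : Rd d → ℝ), (∀ j, BCS (f j)) → BCS g →
    ∃ S : Set (Cube d), IsSparse (1/2) S ∧
      (∫⁻ x, ofFn (T f) x * ofFn g x) ≤ CT * sparseForm S f g

/-- `‖f‖_{L^{p,∞}_u} = sup_{λ>0} λ (u^p({f > λ}))^{1/p}` for `ℝ≥0∞`-valued `f` -/
def eWeakNorm (u : Rd d → ℝ) (p : ℝ) (f : Rd d → ℝ≥0∞) : ℝ≥0∞ :=
  ⨆ (l : ℝ) (_ : 0 < l), ENNReal.ofReal l *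
    (∫⁻ x in {x | ENNReal.ofReal l < f x}, ENNReal.ofReal (u x) ^ p) ^ (1/p)

def weakNorm (u : Rd d → ℝ) (p : ℝ) (f : Rd d → ℝ) : ℝ≥0∞ := eWeakNorm u p (ofFn f)

/-- `‖f‖_{L^p_u} = ‖fu‖_{L^p}` -/
def LpW (u : Rd d → ℝ) (p : ℝ≥0∞) (f : Rd d → ℝ) : ℝ≥0∞ :=
  eLpNorm (fun x => f x * u x) p volume

/-- the linear Muckenhoupt constant `[u]_{A_q}` for `q ∈ (1,∞)` -/
def AqConst (q : ℝ) (u : Rd d → ℝ) : ℝ≥0∞ :=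
  ⨆ Q : Cube d, avg u 1 Q * avg (fun x => u x ^ (1 - q / (q - 1))) 1 Q ^ (q - 1)

/-- normalised Lebesgue measure on a cube -/
def Cube.avgMeasure (Q : Cube d) : Measure (Rd d) :=
  (volume Q.set)⁻¹ • (volume : Measure (Rd d)).restrict Q.set

lemma Cube.volume_set_ne_top (Q : Cube d) : volume Q.set ≠ ∞ := by
  have h : Q.set = Set.pi univ fun i => Ico (Q.corner i) (Q.corner i + Q.side) := by
    ext x
    simp [Cube.set]
  rw [h, Real.volume_pi_Ico]
  exact ENNReal.prod_ne_top fun _ _ => ENNReal.ofReal_ne_top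

lemma Cube.ae_avgMeasure (Q : Cube d) {P : Rd d → Prop} (h : ∀ᵐ x, P x) :
    ∀ᵐ x ∂Q.avgMeasure, P x :=
  Measure.ae_smul_measure (ae_restrict_of_ae h) _

lemma avg_eq_lintegral (f : Rd d → ℝ) (q : ℝ) (Q : Cube d) :
    avg f q Q = (∫⁻ x, ‖f x‖ₑ ^ q ∂Q.avgMeasure) ^ (1 / q) := by
  simp only [avg, eAvg, ofFn, Cube.avgMeasure, lintegral_smul_measure, smul_eq_mul,
    Real.enorm_eq_ofReal_abs]

lemma avgE_eq_eLpNorm (f : Rd d → ℝ) {q : ℝ≥0∞} (hq : q ≠ 0) (Q : Cube d) :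
    avgE f q Q = eLpNorm f q Q.avgMeasure := by
  by_cases h : q = ∞
  · have hc : (volume Q.set)⁻¹ ≠ 0 := ENNReal.inv_ne_zero.2 Q.volume_set_ne_top
    rw [avgE, if_pos h, h, eLpNorm_exponent_top, eLpNormEssSup, Cube.avgMeasure,
      essSup_ennreal_smul_measure hc]
    simp only [Real.enorm_eq_ofReal_abs]
    rfl
  · rw [avgE, if_neg h, avg_eq_lintegral, eLpNorm_eq_lintegral_rpow_enorm_toReal hq h]

/-- the generalised Hölder inequality for a finite product -/
lemma eLpNorm_finset_prod_le {α ι : Type*} [MeasurableSpace α] {μ : Measure α} (s : Finset ι)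
    (f : ι → α → ℝ) (q : ι → ℝ≥0∞) (hf : ∀ i, AEStronglyMeasurable (f i) μ) :
    eLpNorm (fun x => ∏ i ∈ s, f i x) (∑ i ∈ s, (q i)⁻¹)⁻¹ μ ≤
      ∏ i ∈ s, eLpNorm (f i) (q i) μ := by
  classical
  induction s using Finset.induction_on with
  | empty =>
    by_cases hμ : μ = 0
    · simp [hμ]
    · simp [eLpNorm_exponent_top, eLpNormEssSup_const _ hμ]
  | insert a s ha ih =>
    have : HolderTriple (q a) (∑ i ∈ s, (q i)⁻¹)⁻¹ (∑ i ∈ insert a s, (q i)⁻¹)⁻¹ :=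
      ⟨by rw [inv_inv, inv_inv, Finset.sum_insert ha]⟩
    have h := eLpNorm_smul_le_mul_eLpNorm (p := q a) (q := (∑ i ∈ s, (q i)⁻¹)⁻¹)
      (r := (∑ i ∈ insert a s, (q i)⁻¹)⁻¹)
      (Finset.aestronglyMeasurable_fun_prod s fun i _ => hf i) (hf a)
    have e : (fun x => ∏ i ∈ insert a s, f i x) = f a • fun x => ∏ i ∈ s, f i x := by
      ext x
      simp [Finset.prod_insert ha]
    rw [e, Finset.prod_insert ha]
    exact h.trans (mul_le_mul_right ih _)

/-- If `w⃗ ∈ A_{p⃗}` and `mp > 1`, then `w^p ∈ A_{mp}` and `[w^p]_{A_{mp}} ≤ [w⃗]_{p⃗}^p`. -/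
theorem stmt18 (d m : ℕ) (hd : 1 ≤ d) (hm : 1 ≤ m)
    (p : Fin m → ℝ≥0∞) (hp : ∀ j, 1 ≤ p j)
    (p0 : ℝ≥0∞) (hp0top : p0 ≠ ∞) (hp0 : p0⁻¹ = ∑ j, (p j)⁻¹)
    (hmp : 1 < (m : ℝ≥0∞) * p0)
    (w : Fin m → Rd d → ℝ) (hw : ∀ j, IsWeight (w j))
    (hAP : AP p0.toReal p w ≠ ∞) :
    AqConst ((m : ℝ) * p0.toReal) (fun x => prodW w x ^ p0.toReal) ≠ ∞ ∧
      AqConst ((m : ℝ) * p0.toReal) (fun x => prodW w x ^ p0.toReal) ≤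
        AP p0.toReal p w ^ p0.toReal := by
  have hp0zero : p0 ≠ 0 := by
    rintro rfl
    simp at hmp
  set P := p0.toReal with hP
  have hPpos : 0 < P := ENNReal.toReal_pos hp0zero hp0top
  have hq : 0 < (m : ℝ) * P - 1 := by
    have h := (ENNReal.toReal_lt_toReal ENNReal.one_ne_top
      (ENNReal.mul_ne_top (ENNReal.natCast_ne_top m) hp0top)).2 hmp
    simp only [ENNReal.toReal_one, ENNReal.toReal_mul, ENNReal.toReal_natCast] at h
    linarith
  have hfin : ∀ j, (1 - (p j)⁻¹) ≠ ∞ := fun j => ENNReal.sub_ne_top ENNReal.one_ne_top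
  have hinv : ∀ j, (p j)⁻¹ ≤ 1 := fun j => ENNReal.inv_le_one.2 (hp j)
  have hconj : ∀ j, conj (p j) ≠ 0 := fun j => ENNReal.inv_ne_zero.2 (hfin j)
  set σ := ∑ j, (conj (p j))⁻¹ with hσ
  have hσtop : σ ≠ ∞ := ENNReal.sum_ne_top.2 fun j _ => by
    simpa only [conj, inv_inv] using hfin j
  have hσreal : σ.toReal = ((m : ℝ) * P - 1) / P := by
    have h1 : P⁻¹ = ∑ j, ((p j)⁻¹).toReal := by
      rw [hP, ← ENNReal.toReal_inv, hp0, ENNReal.toReal_sum]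
      exact fun j _ => ne_top_of_le_ne_top ENNReal.one_ne_top (hinv j)
    have h2 : σ.toReal = ∑ j, (1 - ((p j)⁻¹).toReal) := by
      simp only [hσ, conj, inv_inv]
      rw [ENNReal.toReal_sum fun j _ => hfin j]
      refine Finset.sum_congr rfl fun j _ => ?_
      rw [ENNReal.toReal_sub_of_le (hinv j) ENNReal.one_ne_top, ENNReal.toReal_one]
    rw [h2, Finset.sum_sub_distrib, ← h1]
    simp
    field_simp
  have hσzero : σ ≠ 0 := by
    intro h
    rw [h, ENNReal.toReal_zero] at hσreal
    exact (div_pos hq hPpos).ne hσreal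
  have hle : AqConst ((m : ℝ) * P) (fun x => prodW w x ^ P) ≤ AP P p w ^ P := by
    refine iSup_le fun Q => ?_
    have hpos : ∀ᵐ x ∂Q.avgMeasure, ∀ j, 0 < w j x :=
      Q.ae_avgMeasure (ae_all_iff.2 fun j => (hw j).2)
    have hmeas : ∀ j, AEStronglyMeasurable (fun x => (w j x)⁻¹) Q.avgMeasure := fun j =>
      ((hw j).1.aestronglyMeasurable.aemeasurable.inv.aestronglyMeasurable.restrict).mono_ac
        Measure.smul_absolutelyContinuous
    have hholder : eLpNorm (fun x => ∏ j, (w j x)⁻¹) σ⁻¹ Q.avgMeasure ≤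
        ∏ j, avgE (fun x => (w j x)⁻¹) (conj (p j)) Q := by
      simp only [avgE_eq_eLpNorm _ (hconj _)]
      exact eLpNorm_finset_prod_le Finset.univ _ _ hmeas
    have hfst : avg (fun x => prodW w x ^ P) 1 Q = avg (prodW w) P Q ^ P := by
      rw [avg_eq_lintegral, avg_eq_lintegral, ← ENNReal.rpow_mul, one_div_mul_cancel hPpos.ne',
        one_div_one]
      simp only [ENNReal.rpow_one]
      refine lintegral_congr_ae (hpos.mono fun x hx => ?_)
      have hx' : 0 ≤ prodW w x := Finset.prod_nonneg fun j _ => (hx j).le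
      simp only [Real.enorm_rpow_of_nonneg hx' hPpos.le]
    have hsnd : avg (fun x => (prodW w x ^ P) ^ (1 - (m : ℝ) * P / ((m : ℝ) * P - 1))) 1 Q ^
        ((m : ℝ) * P - 1) = eLpNorm (fun x => ∏ j, (w j x)⁻¹) σ⁻¹ Q.avgMeasure ^ P := by
      have hexp : 1 / σ⁻¹.toReal * P = (m : ℝ) * P - 1 := by
        rw [ENNReal.toReal_inv, hσreal]
        field_simp
      rw [avg_eq_lintegral, eLpNorm_eq_lintegral_rpow_enorm_toReal
        (ENNReal.inv_ne_zero.2 hσtop) (ENNReal.inv_ne_top.2 hσzero),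
        ← ENNReal.rpow_mul _ (1 / σ⁻¹.toReal) P, hexp,
        one_div_one]
      simp only [ENNReal.rpow_one]
      congr 1
      refine lintegral_congr_ae (hpos.mono fun x hx => ?_)
      have hx' : 0 ≤ prodW w x := Finset.prod_nonneg fun j _ => (hx j).le
      have hexp' : P * (1 - (m : ℝ) * P / ((m : ℝ) * P - 1)) = -σ⁻¹.toReal := by
        rw [ENNReal.toReal_inv, hσreal]
        rw [one_sub_div hq.ne', inv_div]
        ring
      have hprod : ∏ j, (w j x)⁻¹ = (prodW w x)⁻¹ := Finset.prod_inv_distrib _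
      simp only
      rw [hprod, ← Real.rpow_mul hx', hexp', Real.rpow_neg hx', ← Real.inv_rpow hx',
        Real.enorm_rpow_of_nonneg (inv_nonneg.2 hx') ENNReal.toReal_nonneg]
    rw [hfst, hsnd, ← ENNReal.mul_rpow_of_nonneg _ _ hPpos.le]
    refine ENNReal.rpow_le_rpow ((mul_le_mul_right hholder _).trans ?_) hPpos.le
    exact le_iSup (fun Q : Cube d => avg (prodW w) P Q *
      ∏ j, avgE (fun x => (w j x)⁻¹) (conj (p j)) Q) Q
  exact ⟨ne_top_of_le_ne_top (ENNReal.rpow_ne_top_of_nonneg hPpos.le hAP) hle, hle⟩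

end Paper
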